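/- The determinantal hypersurface arrangement H₁₀ in P^14 defined by Q₁₀ = f₁·f₂·f₃·f₄·f₅·f₁₀ is not free; that is, the module of Jacobian syzygies AR(Q₁₀) is not a free S-module. -/

import Mathlib

open MvPolynomial

noncomputable section

/-- The polynomial ring `S = ℂ[x_{i,j} : 1 ≤ i ≤ 3, 1 ≤ j ≤ 5]`,
the entries of the generic `3 × 5` matrix. -/
abbrev S : Type := MvPolynomial (Fin 3 × Fin 5) ℂ

/-- The linear map `(a_v)_v ↦ ∑ v, a_v · ∂F/∂x_v`. -/
def jacMap {R : Type} [CommRing R] {σ : Type} [Fintype σ] [DecidableEq σ]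
    (F : MvPolynomial σ R) : (σ → MvPolynomial σ R) →ₗ[MvPolynomial σ R] MvPolynomial σ R where
  toFun a := ∑ v, a v * pderiv v F
  map_add' a b := by simp [add_mul, Finset.sum_add_distrib]
  map_smul' c a := by simp [Finset.mul_sum, smul_eq_mul, mul_assoc]

/-- The module of Jacobian syzygies `AR(F)`. -/
def AR {R : Type} [CommRing R] {σ : Type} [Fintype σ] [DecidableEq σ]
    (F : MvPolynomial σ R) : Submodule (MvPolynomial σ R) (σ → MvPolynomial σ R) :=
  LinearMap.ker (jacMap F)

/-- The `3`-minor `Δ_{abc}` of the generic `3 × 5` matrix on columns `a, b, c`. -/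
def Δ (a b c : Fin 5) : S :=
  Matrix.det (Matrix.of fun i k : Fin 3 => X (i, ![a, b, c] k))

/-- The ten minors `f₁, …, f₁₀` (zero-indexed: `f 0 = f₁`, …, `f 9 = f₁₀`). -/
def f : Fin 10 → S :=
  ![Δ 0 1 2, Δ 0 1 3, Δ 0 2 3, Δ 1 2 3, Δ 0 1 4,
    Δ 0 2 4, Δ 1 2 4, Δ 0 3 4, Δ 1 3 4, Δ 2 3 4]

/-- A pair of nonzero elements whose syzygies are all multiples of the Koszul one. -/
structure IsRegularPair {R : Type*} [CommRing R] (a b : R) : Prop where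
  left_ne_zero : a ≠ 0
  right_ne_zero : b ≠ 0
  syzygy : ∀ p q : R, a * p + b * q = 0 → ∃ t, p = b * t ∧ q = -(a * t)

/-- Three elements which are pairwise regular and all of whose syzygies are Koszul,
i.e. of the form `(a, b, c) × (x, y, z)`. -/
structure IsRegularTriple {R : Type*} [CommRing R] (a b c : R) : Prop where
  pair_ab : IsRegularPair a b
  pair_ac : IsRegularPair a c
  pair_bc : IsRegularPair b c
  syzygy : ∀ p q r : R, a * p + b * q + c * r = 0 →
    ∃ x y z, p = b * z - c * y ∧ q = c * x - a * z ∧ r = a * y - b * x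

/-- If `c` is regular modulo `I`, then so is `c T + d` modulo the extension of `I` to `R[T]`. -/
theorem Polynomial.mem_map_C_of_linear_mul_mem {R : Type*} [CommRing R] {I : Ideal R} {c d : R}
    (hc : ∀ r, c * r ∈ I → r ∈ I) {p : Polynomial R}
    (hp : (Polynomial.C c * Polynomial.X + Polynomial.C d) * p ∈ I.map Polynomial.C) :
    p ∈ I.map Polynomial.C := by
  have hker : ∀ q : Polynomial R,
      q ∈ I.map Polynomial.C ↔ q.map (Ideal.Quotient.mk I) = 0 := by
    intro q
    simp only [Ideal.mem_map_C_iff, Polynomial.ext_iff, Polynomial.coeff_map,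
      Polynomial.coeff_zero, Ideal.Quotient.eq_zero_iff_mem]
  rw [hker] at hp ⊢
  by_contra hne
  refine hne (Polynomial.leadingCoeff_eq_zero.1 ?_)
  set g := p.map (Ideal.Quotient.mk I) with hg
  have hcoeff := congrArg (fun r => Polynomial.coeff r (g.natDegree + 1)) hp
  simp only [Polynomial.map_mul, Polynomial.map_add, Polynomial.map_C, Polynomial.map_X, ← hg,
    add_mul, mul_assoc, Polynomial.coeff_add, Polynomial.coeff_C_mul, Polynomial.coeff_X_mul,
    Polynomial.coeff_zero, Polynomial.coeff_eq_zero_of_natDegree_lt (Nat.lt_succ_self g.natDegree),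
    mul_zero, add_zero] at hcoeff
  rw [Polynomial.leadingCoeff]
  rw [hg, Polynomial.coeff_map] at hcoeff ⊢
  rw [← map_mul, Ideal.Quotient.eq_zero_iff_mem] at hcoeff
  exact Ideal.Quotient.eq_zero_iff_mem.2 (hc _ hcoeff)

namespace IsRegularPair

variable {R : Type*} [CommRing R] {a b c : R}

theorem symm (h : IsRegularPair a b) : IsRegularPair b a where
  left_ne_zero := h.right_ne_zero
  right_ne_zero := h.left_ne_zero
  syzygy p q hpq := by
    obtain ⟨t, rfl, rfl⟩ := h.syzygy q p (by linear_combination hpq)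
    exact ⟨-t, by ring, by ring⟩

theorem one_right [Nontrivial R] (ha : a ≠ 0) : IsRegularPair a 1 where
  left_ne_zero := ha
  right_ne_zero := one_ne_zero
  syzygy p q hpq := ⟨p, by ring, by linear_combination hpq⟩

theorem polynomial_linear [IsDomain R] (h : IsRegularPair a c) (d : R) :
    IsRegularPair (Polynomial.C a) (Polynomial.C c * Polynomial.X + Polynomial.C d) where
  left_ne_zero := by simpa using h.left_ne_zero
  right_ne_zero h0 := h.right_ne_zero <| by
    simpa using congrArg (fun r => Polynomial.coeff r 1) h0
  syzygy p q hpq := by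
    have ha : Polynomial.C a ≠ 0 := by simpa using h.left_ne_zero
    have hq : q ∈ (Ideal.span {a}).map Polynomial.C := by
      refine Polynomial.mem_map_C_of_linear_mul_mem (c := c) (d := d) (fun r hr => ?_) ?_
      · obtain ⟨s, hs⟩ := Ideal.mem_span_singleton.1 hr
        obtain ⟨t, -, ht⟩ := h.syzygy (-s) r (by linear_combination hs)
        exact Ideal.mem_span_singleton.2 ⟨-t, by linear_combination ht⟩
      · rw [Ideal.map_span, Set.image_singleton, Ideal.mem_span_singleton]
        exact ⟨-p, by linear_combination hpq⟩
    rw [Ideal.map_span, Set.image_singleton, Ideal.mem_span_singleton] at hq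
    obtain ⟨t, rfl⟩ := hq
    exact ⟨-t, mul_left_cancel₀ ha (by linear_combination hpq), by ring⟩

theorem polynomial_C [IsDomain R] (h : IsRegularPair a b) :
    IsRegularPair (Polynomial.C a) (Polynomial.C b) where
  left_ne_zero := by simpa using h.left_ne_zero
  right_ne_zero := by simpa using h.right_ne_zero
  syzygy p q hpq := by
    have hb : Polynomial.C b ≠ 0 := by simpa using h.right_ne_zero
    have hp : p ∈ (Ideal.span {b}).map Polynomial.C := by
      rw [Ideal.mem_map_C_iff]
      intro n
      obtain ⟨t, ht, -⟩ := h.syzygy (p.coeff n) (q.coeff n)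
        (by simpa using congrArg (fun r => Polynomial.coeff r n) hpq)
      exact Ideal.mem_span_singleton.2 ⟨t, ht⟩
    rw [Ideal.map_span, Set.image_singleton, Ideal.mem_span_singleton] at hp
    obtain ⟨t, rfl⟩ := hp
    exact ⟨t, rfl, mul_left_cancel₀ hb (by linear_combination hpq)⟩

/-- Regularity of a pair descends along a ring homomorphism with a left inverse. -/
theorem of_leftInverse {R' : Type*} [CommRing R'] (f : R →+* R') (g : R' →+* R)
    (hgf : ∀ r, g (f r) = r) (h : IsRegularPair (f a) (f b)) : IsRegularPair a b where
  left_ne_zero h0 := h.left_ne_zero (by simp [h0])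
  right_ne_zero h0 := h.right_ne_zero (by simp [h0])
  syzygy p q hpq := by
    obtain ⟨t, hp, hq⟩ := h.syzygy (f p) (f q) (by simp only [← map_mul, ← map_add, hpq, map_zero])
    exact ⟨g t, by simpa [hgf] using congrArg g hp, by simpa [hgf] using congrArg g hq⟩

end IsRegularPair

namespace IsRegularTriple

variable {R : Type*} [CommRing R] {a b c : R}

theorem rotate (h : IsRegularTriple a b c) : IsRegularTriple b c a where
  pair_ab := h.pair_bc
  pair_ac := h.pair_ab.symm
  pair_bc := h.pair_ac.symm
  syzygy p q r hpqr := by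
    obtain ⟨x, y, z, h₁, h₂, h₃⟩ := h.syzygy r p q (by linear_combination hpqr)
    exact ⟨y, z, x, h₂, h₃, h₁⟩

theorem one_right [Nontrivial R] (h : IsRegularPair a b) : IsRegularTriple a b 1 where
  pair_ab := h
  pair_ac := .one_right h.left_ne_zero
  pair_bc := .one_right h.right_ne_zero
  syzygy p q r hpqr := ⟨q, -p, 0, by ring, by ring, by linear_combination hpqr⟩

theorem polynomial_linear [IsDomain R] (h : IsRegularTriple a b c) (d : R) :
    IsRegularTriple (Polynomial.C a) (Polynomial.C b)
      (Polynomial.C c * Polynomial.X + Polynomial.C d) where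
  pair_ab := h.pair_ab.polynomial_C
  pair_ac := h.pair_ac.polynomial_linear d
  pair_bc := h.pair_bc.polynomial_linear d
  syzygy p q r hpqr := by
    have hr : r ∈ (Ideal.span {a, b}).map Polynomial.C := by
      refine Polynomial.mem_map_C_of_linear_mul_mem (c := c) (d := d) (fun s hs => ?_) ?_
      · obtain ⟨u, v, huv⟩ := Ideal.mem_span_pair.1 hs
        obtain ⟨x, y, z, -, -, rfl⟩ := h.syzygy (-u) (-v) s (by linear_combination -huv)
        exact Ideal.mem_span_pair.2 ⟨y, -x, by ring⟩
      · rw [Ideal.map_span, Set.image_pair, Ideal.mem_span_pair]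
        exact ⟨-p, -q, by linear_combination -hpqr⟩
    rw [Ideal.map_span, Set.image_pair, Ideal.mem_span_pair] at hr
    obtain ⟨u, v, rfl⟩ := hr
    obtain ⟨t, hp, hq⟩ := h.pair_ab.polynomial_C.syzygy
      (p + u * (Polynomial.C c * Polynomial.X + Polynomial.C d))
      (q + v * (Polynomial.C c * Polynomial.X + Polynomial.C d)) (by linear_combination hpqr)
    exact ⟨-v, u, t, by linear_combination hp, by linear_combination hq, by ring⟩

theorem of_leftInverse {R' : Type*} [CommRing R'] (f : R →+* R') (g : R' →+* R)
    (hgf : ∀ r, g (f r) = r) (h : IsRegularTriple (f a) (f b) (f c)) : IsRegularTriple a b c where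
  pair_ab := h.pair_ab.of_leftInverse f g hgf
  pair_ac := h.pair_ac.of_leftInverse f g hgf
  pair_bc := h.pair_bc.of_leftInverse f g hgf
  syzygy p q r hpqr := by
    obtain ⟨x, y, z, hp, hq, hr⟩ := h.syzygy (f p) (f q) (f r)
      (by simp only [← map_mul, ← map_add, hpqr, map_zero])
    exact ⟨g x, g y, g z, by simpa [hgf] using congrArg g hp, by simpa [hgf] using congrArg g hq,
      by simpa [hgf] using congrArg g hr⟩

/-- Koszul syzygies suffice over a finite free module as well. -/
theorem syzygy_of_free (h : IsRegularTriple a b c) {M : Type*} [AddCommGroup M] [Module R M]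
    [Module.Free R M] [Module.Finite R M] (p q r : M) (hpqr : a • p + b • q + c • r = 0) :
    ∃ x y z : M, p = b • z - c • y ∧ q = c • x - a • z ∧ r = a • y - b • x := by
  let e := (Module.Free.chooseBasis R M).equivFun
  choose x y z hp hq hr using fun i => h.syzygy (e p i) (e q i) (e r i)
    (by simpa using congrFun (congrArg e hpqr) i)
  refine ⟨e.symm x, e.symm y, e.symm z, ?_, ?_, ?_⟩ <;> apply e.injective <;> ext i
  · simpa using hp i
  · simpa using hq i
  · simpa using hr i

/-- If the kernel of `D : Rⁿ → R` is free, then no regular triple multiplies an element outside the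
image of `D` into this image. -/
theorem mem_range_of_free_ker [IsDomain R] [IsNoetherianRing R] (h : IsRegularTriple a b c)
    {ι : Type*} [Fintype ι] (D : (ι → R) →ₗ[R] R) [Module.Free R (LinearMap.ker D)] {u : R}
    (ha : a * u ∈ LinearMap.range D) (hb : b * u ∈ LinearMap.range D)
    (hc : c * u ∈ LinearMap.range D) : u ∈ LinearMap.range D := by
  obtain ⟨w₁, hw₁⟩ := ha
  obtain ⟨w₂, hw₂⟩ := hb
  obtain ⟨w₃, hw₃⟩ := hc
  have hp : b • w₃ - c • w₂ ∈ LinearMap.ker D := by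
    simp only [LinearMap.mem_ker, map_sub, map_smul, hw₂, hw₃, smul_eq_mul]; ring
  have hq : c • w₁ - a • w₃ ∈ LinearMap.ker D := by
    simp only [LinearMap.mem_ker, map_sub, map_smul, hw₁, hw₃, smul_eq_mul]; ring
  have hr : a • w₂ - b • w₁ ∈ LinearMap.ker D := by
    simp only [LinearMap.mem_ker, map_sub, map_smul, hw₁, hw₂, smul_eq_mul]; ring
  obtain ⟨x, y, -, -, -, hxy⟩ := h.syzygy_of_free
    (⟨_, hp⟩ : LinearMap.ker D) ⟨_, hq⟩ ⟨_, hr⟩ (by ext i; simp; ring)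
  have hxy' : a • w₂ - b • w₁ = a • (y : ι → R) - b • (x : ι → R) := congrArg Subtype.val hxy
  choose t _ ht using fun i => h.pair_ab.syzygy (w₂ i - (y : ι → R) i) ((x : ι → R) i - w₁ i)
    (by
      have := congrFun hxy' i
      simp only [Pi.sub_apply, Pi.smul_apply, smul_eq_mul] at this
      linear_combination this)
  have hw : w₁ = (x : ι → R) + a • t := by
    ext i
    simp only [Pi.add_apply, Pi.smul_apply, smul_eq_mul]
    linear_combination -ht i
  refine ⟨t, mul_left_cancel₀ h.pair_ab.left_ne_zero ?_⟩
  rw [← hw₁, hw, map_add, LinearMap.mem_ker.1 x.2, map_smul, zero_add, smul_eq_mul]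

end IsRegularTriple

namespace MvPolynomial

variable {σ R : Type*} [CommRing R]

theorem IsHomogeneous.aeval_C_mul_X {p : MvPolynomial σ R} {n : ℕ} (hp : p.IsHomogeneous n)
    (x : σ → R) : MvPolynomial.aeval (fun v => Polynomial.C (x v) * Polynomial.X) p =
      Polynomial.C (eval x p) * Polynomial.X ^ n := by
  rw [aeval_def, eval₂_eq, eval_eq, map_sum, Finset.sum_mul]
  refine Finset.sum_congr rfl fun d hd => ?_
  have hdeg : ∑ i ∈ d.support, d i = n := by
    rw [← hp (mem_support_iff.1 hd), Finsupp.weight_apply, Finsupp.sum]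
    simp
  simp only [mul_pow, Finset.prod_mul_distrib, Finset.prod_pow_eq_pow_sum, hdeg, map_mul, map_prod,
    map_pow, ← Polynomial.C_eq_algebraMap, mul_assoc, ← Polynomial.algebraMap_eq]

/-- A form of degree `n` in the ideal generated by forms of degree `n` is a combination of these
with constant coefficients. -/
theorem IsHomogeneous.eval_eq_sum_constantCoeff [IsDomain R] {ι : Type*} [Fintype ι] {n : ℕ}
    {p : MvPolynomial σ R} {g a : ι → MvPolynomial σ R} (hp : p.IsHomogeneous n)
    (hg : ∀ i, (g i).IsHomogeneous n) (h : ∑ i, a i * g i = p) (x : σ → R) :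
    ∑ i, constantCoeff (a i) * eval x (g i) = eval x p := by
  have hx := congrArg (MvPolynomial.aeval fun v => Polynomial.C (x v) * Polynomial.X) h
  simp only [map_sum, map_mul, (hg _).aeval_C_mul_X, hp.aeval_C_mul_X, ← mul_assoc,
    ← Finset.sum_mul] at hx
  have h₀ := congrArg (Polynomial.eval 0) (mul_right_cancel₀ (pow_ne_zero n Polynomial.X_ne_zero) hx)
  have hc : ∀ q : MvPolynomial σ R,
      (MvPolynomial.aeval (fun v => Polynomial.C (x v) * Polynomial.X) q : Polynomial R).eval 0 =
        constantCoeff q := by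
    intro q
    induction q using MvPolynomial.induction_on <;> simp_all
  simpa [Polynomial.eval_finsetSum, hc] using h₀

variable [DecidableEq σ]

/-- Polynomials regarded as polynomials in the single variable `v`, the coefficients being
polynomials in the other variables. -/
def isolate (v : σ) : MvPolynomial σ R →ₐ[R] Polynomial (MvPolynomial σ R) :=
  aeval (Function.update (fun w => Polynomial.C (X w)) v Polynomial.X)

theorem isolate_X (v w : σ) : isolate v (X w : MvPolynomial σ R) =
    if w = v then Polynomial.X else Polynomial.C (X w) := by
  simp [isolate, Function.update_apply]

theorem eval_isolate (v : σ) (p : MvPolynomial σ R) : (isolate v p).eval (X v) = p := by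
  have : ((Polynomial.aeval (X v : MvPolynomial σ R)).restrictScalars R).comp (isolate v) =
      AlgHom.id R (MvPolynomial σ R) := by
    ext w
    by_cases hw : w = v <;> simp [isolate_X, hw]
  simpa using DFunLike.congr_fun this p

theorem isRegularPair_linear [IsDomain R] (v : σ) {a c d : MvPolynomial σ R}
    (h : IsRegularPair a c) (ha : isolate v a = Polynomial.C a)
    (hc : isolate v c = Polynomial.C c) (hd : isolate v d = Polynomial.C d) :
    IsRegularPair a (c * X v + d) := by
  refine .of_leftInverse (isolate v).toRingHom (Polynomial.evalRingHom (X v)) (eval_isolate v) ?_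
  simpa [ha, hc, hd, isolate_X] using h.polynomial_linear d

theorem isRegularTriple_linear [IsDomain R] (v : σ) {a b c d : MvPolynomial σ R}
    (h : IsRegularTriple a b c) (ha : isolate v a = Polynomial.C a)
    (hb : isolate v b = Polynomial.C b) (hc : isolate v c = Polynomial.C c)
    (hd : isolate v d = Polynomial.C d) : IsRegularTriple a b (c * X v + d) := by
  refine .of_leftInverse (isolate v).toRingHom (Polynomial.evalRingHom (X v)) (eval_isolate v) ?_
  simpa [ha, hb, hc, hd, isolate_X] using h.polynomial_linear d

end MvPolynomial

theorem Δ_eq (a b c : Fin 5) : Δ a b c =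
    X (0, a) * (X (1, b) * X (2, c) - X (1, c) * X (2, b)) -
      X (0, b) * (X (1, a) * X (2, c) - X (1, c) * X (2, a)) +
      X (0, c) * (X (1, a) * X (2, b) - X (1, b) * X (2, a)) := by
  rw [Δ, Matrix.det_fin_three]
  simp only [Matrix.of_apply, Matrix.cons_val]
  ring

theorem Δ_isHomogeneous (a b c : Fin 5) : (Δ a b c).IsHomogeneous 3 := by
  rw [Δ_eq]
  have h : ∀ i j k l m n : Fin 3 × Fin 5,
      (X i * (X j * X k - X l * X m) : S).IsHomogeneous 3 := fun i j k l m n =>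
    (isHomogeneous_X _ _).mul
      (((isHomogeneous_X _ _).mul (isHomogeneous_X _ _)).sub
        ((isHomogeneous_X _ _).mul (isHomogeneous_X _ _)))
  exact ((h _ _ _ _ _ (0, 0)).sub (h _ _ _ _ _ (0, 0))).add (h _ _ _ _ _ (0, 0))

/-- The minor of the generic matrix on rows `i, j` and columns `a, b`. -/
def minorTwo (i j : Fin 3) (a b : Fin 5) : S := X (i, a) * X (j, b) - X (j, a) * X (i, b)

/-- Laplace expansion along the last column. -/
theorem laplace_lastColumn (a b c : Fin 5) : X (0, c) * minorTwo 1 2 a b -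
    X (1, c) * minorTwo 0 2 a b + X (2, c) * minorTwo 0 1 a b = Δ a b c := by
  simp only [Δ_eq, minorTwo]
  ring

theorem Δ_rotate (a b c : Fin 5) : Δ b c a = Δ a b c := by
  simp only [Δ_eq]
  ring

theorem Δ_swap (a b c : Fin 5) : Δ b a c = -Δ a b c := by
  simp only [Δ_eq]
  ring

theorem Δ_self_left (a b : Fin 5) : Δ a b a = 0 := by
  simp only [Δ_eq]
  ring

theorem Δ_self_right (a b : Fin 5) : Δ a b b = 0 := by
  simp only [Δ_eq]
  ring

theorem isRegularTriple_minors : IsRegularTriple (Δ 0 2 3) (Δ 1 2 3) (Δ 1 0 4) := by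
  have h₀ : IsRegularPair (X (0, 0) : S) (X (0, 2)) := by
    simpa using isRegularPair_linear (0, 2) (.one_right (X_ne_zero (0, 0))) (d := 0)
      (by simp [isolate_X]) (by simp) (by simp)
  have h₁ : IsRegularTriple (X (0, 0) : S) (X (0, 2)) (X (1, 0)) := by
    simpa using isRegularTriple_linear (1, 0) (.one_right h₀) (d := 0)
      (by simp [isolate_X]) (by simp [isolate_X]) (by simp) (by simp)
  have h₂ : IsRegularTriple (X (0, 0) : S) (X (0, 2)) (minorTwo 1 0 0 1) := by
    convert isRegularTriple_linear (0, 1) h₁ (d := -(X (0, 0) * X (1, 1))) ?_ ?_ ?_ ?_ using 1 <;>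
      simp [isolate_X, minorTwo, sub_eq_add_neg]
  have h₃ : IsRegularTriple (X (0, 2)) (minorTwo 1 0 0 1) (minorTwo 0 1 0 2) := by
    convert isRegularTriple_linear (1, 2) h₂.rotate
      (d := -(X (1, 0) * X (0, 2))) ?_ ?_ ?_ ?_ using 1 <;>
      simp [isolate_X, minorTwo, sub_eq_add_neg]
  have h₄ : IsRegularTriple (minorTwo 1 0 0 1) (minorTwo 0 1 0 2) (minorTwo 0 1 2 3) := by
    convert isRegularTriple_linear (1, 3) h₃.rotate
      (d := -(X (1, 2) * X (0, 3))) ?_ ?_ ?_ ?_ using 1 <;>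
      simp [isolate_X, minorTwo, sub_eq_add_neg]
  have h₅ : IsRegularTriple (minorTwo 0 1 2 3) (minorTwo 1 0 0 1) (Δ 0 2 3) := by
    convert isRegularTriple_linear (2, 3) h₄.rotate.rotate
      (d := X (2, 0) * minorTwo 0 1 2 3 - X (2, 2) * minorTwo 0 1 0 3) ?_ ?_ ?_ ?_ using 1
    on_goal 1 => rw [Δ_eq, minorTwo, minorTwo, minorTwo]; ring
    all_goals simp [isolate_X, minorTwo]
  have h₆ : IsRegularTriple (minorTwo 1 0 0 1) (Δ 0 2 3) (Δ 1 2 3) := by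
    convert isRegularTriple_linear (2, 1) h₅.rotate
      (d := X (2, 3) * minorTwo 0 1 1 2 - X (2, 2) * minorTwo 0 1 1 3) ?_ ?_ ?_ ?_ using 1
    on_goal 1 => rw [Δ_eq, minorTwo, minorTwo, minorTwo]; ring
    all_goals simp [isolate_X, minorTwo, Δ_eq]
  convert isRegularTriple_linear (2, 4) h₆.rotate
    (d := X (2, 1) * minorTwo 0 1 0 4 - X (2, 0) * minorTwo 0 1 1 4) ?_ ?_ ?_ ?_ using 1
  on_goal 1 => rw [Δ_eq, minorTwo, minorTwo, minorTwo]; ring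
  all_goals simp [isolate_X, minorTwo, Δ_eq]

/-- The derivative of `Q₁₀` along a vector field `a` supported in the last column, which occurs
only in the factors `Δ 0 1 4` and `Δ 2 3 4`. -/
theorem jacMap_lastColumn (a : Fin 3 → S) :
    jacMap (f 0 * f 1 * f 2 * f 3 * f 4 * f 9) (fun v => if v.2 = 4 then a v.1 else 0) =
      Δ 0 1 2 * Δ 0 1 3 * Δ 0 2 3 * Δ 1 2 3 *
        ((a 0 * minorTwo 1 2 0 1 - a 1 * minorTwo 0 2 0 1 + a 2 * minorTwo 0 1 0 1) * Δ 2 3 4 +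
          Δ 0 1 4 *
            (a 0 * minorTwo 1 2 2 3 - a 1 * minorTwo 0 2 2 3 + a 2 * minorTwo 0 1 2 3)) := by
  have hconst : ∀ (i : Fin 3) (j k l : Fin 5), j ≠ 4 → k ≠ 4 → l ≠ 4 →
      pderiv (i, 4) (Δ j k l) = 0 := by
    intro i j k l hj hk hl
    simp [Δ_eq, pderiv_X, hj, hk, hl]
  have hlast : ∀ j k : Fin 5, j ≠ 4 → k ≠ 4 →
      pderiv (0, 4) (Δ j k 4) = minorTwo 1 2 j k ∧ pderiv (1, 4) (Δ j k 4) = -minorTwo 0 2 j k ∧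
        pderiv (2, 4) (Δ j k 4) = minorTwo 0 1 j k := by
    intro j k hj hk
    refine ⟨?_, ?_, ?_⟩ <;>
    · simp [Δ_eq, pderiv_X, hj, hk, minorTwo]
      try ring
  have h01 := hlast 0 1 (by decide) (by decide)
  have h23 := hlast 2 3 (by decide) (by decide)
  change ∑ v : Fin 3 × Fin 5, (if v.2 = 4 then a v.1 else 0) * pderiv v
    (Δ 0 1 2 * Δ 0 1 3 * Δ 0 2 3 * Δ 1 2 3 * Δ 0 1 4 * Δ 2 3 4) = _
  simp only [ite_mul, zero_mul, Fintype.sum_prod_type, Finset.sum_ite_eq', Finset.mem_univ, if_true,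
    Fin.sum_univ_three, pderiv_mul, h01, h23, hconst _ 0 1 2 (by decide) (by decide) (by decide),
    hconst _ 0 1 3 (by decide) (by decide) (by decide),
    hconst _ 0 2 3 (by decide) (by decide) (by decide),
    hconst _ 1 2 3 (by decide) (by decide) (by decide)]
  ring

/-- An element which is not in the Jacobian ideal although its multiples by the regular triple
of `isRegularTriple_minors` are. -/
theorem notMem_range_jacMap : Δ 0 1 2 * Δ 0 1 3 * Δ 0 2 3 * Δ 1 2 3 * Δ 0 1 4 * minorTwo 1 2 2 3 ∉
    LinearMap.range (jacMap (f 0 * f 1 * f 2 * f 3 * f 4 * f 9)) := by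
  rintro ⟨a, ha⟩
  have hm : (minorTwo 1 2 2 3).IsHomogeneous 2 :=
    ((isHomogeneous_X _ _).mul (isHomogeneous_X _ _)).sub
      ((isHomogeneous_X _ _).mul (isHomogeneous_X _ _))
  have hQ : (Δ 0 1 2 * Δ 0 1 3 * Δ 0 2 3 * Δ 1 2 3 * Δ 0 1 4 * Δ 2 3 4).IsHomogeneous 18 :=
    ((((((Δ_isHomogeneous _ _ _).mul (Δ_isHomogeneous _ _ _)).mul (Δ_isHomogeneous _ _ _)).mul
      (Δ_isHomogeneous _ _ _)).mul (Δ_isHomogeneous _ _ _)).mul (Δ_isHomogeneous _ _ _))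
  have hu : (Δ 0 1 2 * Δ 0 1 3 * Δ 0 2 3 * Δ 1 2 3 * Δ 0 1 4 * minorTwo 1 2 2 3).IsHomogeneous 17 :=
    ((((((Δ_isHomogeneous _ _ _).mul (Δ_isHomogeneous _ _ _)).mul (Δ_isHomogeneous _ _ _)).mul
      (Δ_isHomogeneous _ _ _)).mul (Δ_isHomogeneous _ _ _)).mul hm)
  have key := hu.eval_eq_sum_constantCoeff
    (g := fun v => pderiv v (Δ 0 1 2 * Δ 0 1 3 * Δ 0 2 3 * Δ 1 2 3 * Δ 0 1 4 * Δ 2 3 4))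
    (fun v => hQ.pderiv) ha
  have p₁ : ∀ s : ℂ, s ≠ 0 → constantCoeff (a (0, 4)) = s * constantCoeff (a (0, 0)) := by
    intro s hs
    have := key fun v => !![0, 0, 1, 1, 0; 1, 0, 0, 1, s; 0, 1, 0, 1, 0] v.1 v.2
    simp [Fintype.sum_prod_type, Fin.sum_univ_succ, pderiv_X, Pi.single_apply, Δ_eq, minorTwo,
      Derivation.leibniz] at this
    exact mul_left_cancel₀ hs (by linear_combination this)
  have p₂ : ∀ s : ℂ, s ≠ 0 → constantCoeff (a (0, 4)) = 1 + s * constantCoeff (a (0, 2)) := by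
    intro s hs
    have := key fun v => !![1, 1, 0, 0, 0; 0, 1, 1, 0, s; 0, 1, 0, 1, 0] v.1 v.2
    simp [Fintype.sum_prod_type, Fin.sum_univ_succ, pderiv_X, Pi.single_apply, Δ_eq, minorTwo,
      Derivation.leibniz] at this
    exact mul_left_cancel₀ hs (by linear_combination this)
  have h₁ := p₁ 1 one_ne_zero
  have h₂ := p₁ 2 two_ne_zero
  have h₃ := p₂ 1 one_ne_zero
  have h₄ := p₂ 2 two_ne_zero
  have : (1 : ℂ) = 0 := by linear_combination 2 * h₁ - h₂ - 2 * h₃ + h₄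
  exact one_ne_zero this

/-- The arrangement `H₁₀ : Q₁₀ = f₁ f₂ f₃ f₄ f₅ f₁₀ = 0` is not free. -/
theorem not_free_H_ten : ¬ Module.Free S (AR (f 0 * f 1 * f 2 * f 3 * f 4 * f 9)) := by
  intro hfree
  have : Module.Free S (LinearMap.ker (jacMap (f 0 * f 1 * f 2 * f 3 * f 4 * f 9))) := hfree
  refine notMem_range_jacMap (isRegularTriple_minors.mem_range_of_free_ker _ ?_ ?_ ?_)
  · refine ⟨_, (jacMap_lastColumn fun i => minorTwo 1 2 2 3 * X (i, 0)).trans ?_⟩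
    have h₁ := (laplace_lastColumn 0 1 0).trans (Δ_self_left 0 1)
    have h₂ := (laplace_lastColumn 2 3 0).trans (Δ_rotate 0 2 3)
    linear_combination Δ 0 1 2 * Δ 0 1 3 * Δ 0 2 3 * Δ 1 2 3 * minorTwo 1 2 2 3 *
      (Δ 2 3 4 * h₁ + Δ 0 1 4 * h₂)
  · refine ⟨_, (jacMap_lastColumn fun i => minorTwo 1 2 2 3 * X (i, 1)).trans ?_⟩
    have h₁ := (laplace_lastColumn 0 1 1).trans (Δ_self_right 0 1)
    have h₂ := (laplace_lastColumn 2 3 1).trans (Δ_rotate 1 2 3)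
    linear_combination Δ 0 1 2 * Δ 0 1 3 * Δ 0 2 3 * Δ 1 2 3 * minorTwo 1 2 2 3 *
      (Δ 2 3 4 * h₁ + Δ 0 1 4 * h₂)
  · refine ⟨_, (jacMap_lastColumn ![C (1 / 2) * minorTwo 1 2 0 1 * X (0, 4) - Δ 0 1 4,
      C (1 / 2) * minorTwo 1 2 0 1 * X (1, 4), C (1 / 2) * minorTwo 1 2 0 1 * X (2, 4)]).trans ?_⟩
    have h₀ : (C (1 / 2) * 2 : S) = 1 := by
      rw [show (2 : S) = C 2 from (map_ofNat C 2).symm, ← C_mul]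
      norm_num
    have h₁ := laplace_lastColumn 0 1 4
    have h₂ := laplace_lastColumn 2 3 4
    rw [Δ_swap 0 1 4]
    simp only [Matrix.cons_val]
    linear_combination Δ 0 1 2 * Δ 0 1 3 * Δ 0 2 3 * Δ 1 2 3 * minorTwo 1 2 0 1 *
      (C (1 / 2) * (Δ 2 3 4 * h₁ + Δ 0 1 4 * h₂) + Δ 0 1 4 * Δ 2 3 4 * h₀)
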